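/- arXiv:2108.03664 — 2 statements merged into one kernel-verified Lean document; each statement's English description precedes it below -/
import Mathlib

section
/- Let b ≥ 2 be an integer. For each even positive integer n, each finite sequence (a_1,…,a_n) of positive integers, and each integer k ≥ 0, there is at most one integer c with b^k ≤ c ≤ b^{k+1}−1 such that the open interval I(a_1,…,a_n,c) with endpoints [0;a_1,…,a_n,c] and [0;a_1,…,a_n,c+1] contains a Trott number in base b. -/
open Filter Topology

/-- Number of digits of `a` in base `b`. -/
def digLen (b a : ℕ) : ℕ := (Nat.digits b a).length

/-- Value of the finite continued fraction `[0; a₁, a₂, …, aₙ]`. -/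
noncomputable def cfVal : List ℕ → ℝ
  | [] => 0
  | (h :: t) => 1 / ((h : ℝ) + cfVal t)

/-- `a` witnesses that `x` is a Trott number in base `b`: the `a i` (indexed from 0)
are positive, `x` is the value of the infinite continued fraction `[0; a 0, a 1, …]`,
and the base-`b` expansion of `x` is the concatenation of the base-`b` digit strings
of the partial quotients. -/
def IsTrottWith (b : ℕ) (x : ℝ) (a : ℕ → ℕ) : Prop :=
  (∀ i, 0 < a i) ∧
  Tendsto (fun n => cfVal ((List.range n).map a)) atTop (𝓝 x) ∧
  x = ∑' i : ℕ, (a i : ℝ) / (b : ℝ) ^ (∑ j ∈ Finset.range (i + 1), digLen b (a j))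

/-- `x` is a Trott number in base `b`. -/
def IsTrott (b : ℕ) (x : ℝ) : Prop := ∃ a, IsTrottWith b x a

/-- The set of Trott numbers in base `b`. -/
def TrottSet (b : ℕ) : Set ℝ := {x | IsTrott b x}

/-- The finite continued fraction of a list of positive integers lies in `[0, 1]`. -/
theorem cfVal_mem_Icc (L : List ℕ) (hL : ∀ d ∈ L, 0 < d) : cfVal L ∈ Set.Icc (0 : ℝ) 1 := by
  induction L with
  | nil => simp [cfVal]
  | cons h t ih =>
    have ht := ih fun d hd => hL d (List.mem_cons_of_mem _ hd)
    have hh : (1 : ℝ) ≤ h := by exact_mod_cast hL h List.mem_cons_self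
    have hpos : (1 : ℝ) ≤ h + cfVal t := by linarith [ht.1]
    rw [cfVal]
    exact ⟨by positivity, (div_le_one (by linarith)).2 hpos⟩

theorem cfVal_map_range_succ (a : ℕ → ℕ) (n : ℕ) :
    cfVal ((List.range (n + 1)).map a) =
      1 / ((a 0 : ℝ) + cfVal ((List.range n).map fun i => a (i + 1))) := by
  rw [List.range_succ_eq_map, List.map_cons, List.map_map, cfVal]
  rfl

theorem cfVal_map_range_mem_Icc {a : ℕ → ℕ} (ha : ∀ i, 0 < a i) (n : ℕ) :
    cfVal ((List.range n).map a) ∈ Set.Icc (0 : ℝ) 1 := by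
  apply cfVal_mem_Icc
  simp only [List.mem_map]
  rintro _ ⟨i, -, rfl⟩
  exact ha i

section InfiniteContinuedFraction

variable {a : ℕ → ℕ} {x : ℝ}

theorem pos_of_tendsto_cfVal (ha : ∀ i, 0 < a i)
    (hx : Tendsto (fun n => cfVal ((List.range n).map a)) atTop (𝓝 x)) : 0 < x := by
  have h0 : (0 : ℝ) < a 0 := by exact_mod_cast ha 0
  refine lt_of_lt_of_le (by positivity : (0 : ℝ) < 1 / ((a 0 : ℝ) + 1))
    (ge_of_tendsto' ((tendsto_add_atTop_iff_nat 1).2 hx) fun n => ?_)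
  have ht := cfVal_map_range_mem_Icc (fun i => ha (i + 1)) n
  rw [cfVal_map_range_succ]
  exact one_div_le_one_div_of_le (by linarith [ht.1]) (by linarith [ht.2])

/-- Dropping the first partial quotient of an infinite continued fraction. -/
theorem tendsto_cfVal_tail (ha : ∀ i, 0 < a i)
    (hx : Tendsto (fun n => cfVal ((List.range n).map a)) atTop (𝓝 x)) :
    Tendsto (fun n => cfVal ((List.range n).map fun i => a (i + 1))) atTop
      (𝓝 (1 / x - a 0)) := by
  have h := (((tendsto_add_atTop_iff_nat 1).2 hx).inv₀
    (pos_of_tendsto_cfVal ha hx).ne').sub_const (a 0 : ℝ)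
  rw [one_div]
  refine h.congr fun n => ?_
  rw [cfVal_map_range_succ, one_div, inv_inv]
  ring

theorem lt_one_of_tendsto_cfVal (ha : ∀ i, 0 < a i)
    (hx : Tendsto (fun n => cfVal ((List.range n).map a)) atTop (𝓝 x)) : x < 1 := by
  have hpos := pos_of_tendsto_cfVal ha hx
  have htail := pos_of_tendsto_cfVal (fun i => ha (i + 1)) (tendsto_cfVal_tail ha hx)
  have h0 : (1 : ℝ) ≤ a 0 := by exact_mod_cast ha 0
  have : 1 < 1 / x := by linarith
  rwa [lt_one_div one_pos hpos, div_one] at this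

theorem first_quotient_eq (ha : ∀ i, 0 < a i)
    (hx : Tendsto (fun n => cfVal ((List.range n).map a)) atTop (𝓝 x)) {c : ℕ}
    (h₁ : (c : ℝ) < 1 / x) (h₂ : 1 / x < c + 1) : a 0 = c := by
  have htail := tendsto_cfVal_tail ha hx
  have hpos := pos_of_tendsto_cfVal (fun i => ha (i + 1)) htail
  have hlt := lt_one_of_tendsto_cfVal (fun i => ha (i + 1)) htail
  have h₃ : a 0 < c + 1 := by
    have : (a 0 : ℝ) < c + 1 := by linarith
    exact_mod_cast this
  have h₄ : c < a 0 + 1 := by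
    have : (c : ℝ) < a 0 + 1 := by linarith
    exact_mod_cast this
  omega

end InfiniteContinuedFraction

/-- The map `x ↦ 1 / x - h` sends the interval with endpoints `1 / (h + u)` and `1 / (h + v)`
to the one with endpoints `u` and `v`. -/
theorem one_div_sub_mem_uIoo {h u v x : ℝ} (hu : 0 < h + u) (hv : 0 < h + v)
    (hx : x ∈ Set.uIoo (1 / (h + u)) (1 / (h + v))) : 1 / x - h ∈ Set.uIoo u v := by
  have key : ∀ {p q : ℝ}, 0 < p → 0 < q → 1 / p < x → x < 1 / q → q < 1 / x ∧ 1 / x < p := by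
    intro p q hp hq h₁ h₂
    have hx0 : 0 < x := (one_div_pos.2 hp).trans h₁
    exact ⟨(lt_one_div hx0 hq).1 h₂, (one_div_lt hp hx0).1 h₁⟩
  rcases le_total u v with huv | huv
  · rw [Set.uIoo_of_ge (one_div_le_one_div_of_le hu (by linarith))] at hx
    rw [Set.uIoo_of_le huv]
    obtain ⟨h₁, h₂⟩ := key hv hu hx.1 hx.2
    exact ⟨by linarith, by linarith⟩
  · rw [Set.uIoo_of_le (one_div_le_one_div_of_le hv (by linarith))] at hx
    rw [Set.uIoo_of_ge huv]
    obtain ⟨h₁, h₂⟩ := key hu hv hx.1 hx.2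
    exact ⟨by linarith, by linarith⟩

theorem pos_of_mem_append_singleton {L : List ℕ} {c : ℕ} (hL : ∀ d ∈ L, 0 < d) (hc : 0 < c) :
    ∀ d ∈ L ++ [c], 0 < d := by
  intro d hd
  rcases List.mem_append.1 hd with hd | hd
  · exact hL d hd
  · rwa [List.mem_singleton.1 hd]

/-- A number in the fundamental interval of `L ++ [c]` has a continued fraction
starting with `L ++ [c]`. -/
theorem map_range_eq_of_mem_uIoo (L : List ℕ) (hL : ∀ d ∈ L, 0 < d) {c : ℕ} (hc : 0 < c)
    {a : ℕ → ℕ} (ha : ∀ i, 0 < a i) {x : ℝ}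
    (hx : Tendsto (fun n => cfVal ((List.range n).map a)) atTop (𝓝 x))
    (hmem : x ∈ Set.uIoo (cfVal (L ++ [c])) (cfVal (L ++ [c + 1]))) :
    (List.range (L.length + 1)).map a = L ++ [c] := by
  induction L generalizing a x with
  | nil =>
    have hc' : (0 : ℝ) < c := by exact_mod_cast hc
    have h : 1 / x - 0 ∈ Set.uIoo (c : ℝ) (c + 1) := by
      refine one_div_sub_mem_uIoo (by linarith) (by linarith) ?_
      simpa [cfVal] using hmem
    rw [Set.uIoo_of_le (by linarith), sub_zero] at h
    simpa using first_quotient_eq ha hx h.1 h.2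
  | cons h t ih =>
    have ht : ∀ d ∈ t, 0 < d := fun d hd => hL d (List.mem_cons_of_mem _ hd)
    have hh : (0 : ℝ) < h := by exact_mod_cast hL h List.mem_cons_self
    have hu := cfVal_mem_Icc _ (pos_of_mem_append_singleton ht hc)
    have hv := cfVal_mem_Icc _ (pos_of_mem_append_singleton ht c.succ_pos)
    have hy : 1 / x - h ∈ Set.uIoo (cfVal (t ++ [c])) (cfVal (t ++ [c + 1])) :=
      one_div_sub_mem_uIoo (by linarith [hu.1]) (by linarith [hv.1]) hmem
    have hy' : 0 < 1 / x - h ∧ 1 / x - h < 1 :=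
      ⟨(le_min hu.1 hv.1).trans_lt hy.1, hy.2.trans_le (max_le hu.2 hv.2)⟩
    have h0 : a 0 = h := first_quotient_eq ha hx (by linarith) (by linarith)
    have htail := tendsto_cfVal_tail ha hx
    rw [h0] at htail
    have := ih ht (fun i => ha (i + 1)) htail hy
    rw [List.length_cons, List.range_succ_eq_map, List.map_cons, List.map_map, h0,
      List.cons_append, ← this]
    rfl

/-- The dependence of a finite continued fraction on its last partial quotient is antitone or
monotone according to the parity of its position. -/
theorem cfVal_append_singleton_le (L : List ℕ) (hL : ∀ d ∈ L, 0 < d) {c d : ℕ} (hc : 0 < c)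
    (hcd : c ≤ d) :
    (Even L.length → cfVal (L ++ [d]) ≤ cfVal (L ++ [c])) ∧
      (¬ Even L.length → cfVal (L ++ [c]) ≤ cfVal (L ++ [d])) := by
  induction L with
  | nil =>
    have hc' : (0 : ℝ) < c := by exact_mod_cast hc
    have hcd' : (c : ℝ) ≤ d := by exact_mod_cast hcd
    simpa [cfVal] using inv_anti₀ hc' hcd'
  | cons h t ih =>
    have ht : ∀ d ∈ t, 0 < d := fun d hd => hL d (List.mem_cons_of_mem _ hd)
    have hh : (0 : ℝ) < h := by exact_mod_cast hL h List.mem_cons_self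
    have hu := (cfVal_mem_Icc _ (pos_of_mem_append_singleton ht hc)).1
    have hv := (cfVal_mem_Icc _ (pos_of_mem_append_singleton ht (hc.trans_le hcd))).1
    obtain ⟨ih₁, ih₂⟩ := ih ht
    simp only [List.length_cons, Nat.even_add_one, List.cons_append, cfVal, not_not]
    exact ⟨fun he => one_div_le_one_div_of_le (by linarith) (by linarith [ih₂ he]),
      fun he => one_div_le_one_div_of_le (by linarith) (by linarith [ih₁ he])⟩

/-- A concatenated base-`b` expansion lies between its truncation and the truncation plus one
unit in the last place. -/
theorem tsum_digits_mem_Icc {b : ℕ} (hb : 2 ≤ b) (a : ℕ → ℕ) (m : ℕ) :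
    (∑' i : ℕ, (a i : ℝ) / (b : ℝ) ^ (∑ j ∈ Finset.range (i + 1), digLen b (a j))) ∈
      Set.Icc
        (∑ i ∈ Finset.range m, (a i : ℝ) / (b : ℝ) ^ (∑ j ∈ Finset.range (i + 1), digLen b (a j)))
        (∑ i ∈ Finset.range m, (a i : ℝ) / (b : ℝ) ^ (∑ j ∈ Finset.range (i + 1), digLen b (a j))
          + 1 / (b : ℝ) ^ (∑ j ∈ Finset.range m, digLen b (a j))) := by
  set f : ℕ → ℝ := fun i => (a i : ℝ) / (b : ℝ) ^ (∑ j ∈ Finset.range (i + 1), digLen b (a j))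
    with hf
  set r : ℕ → ℝ := fun i => 1 / (b : ℝ) ^ (∑ j ∈ Finset.range i, digLen b (a j)) with hr
  have hb0 : (0 : ℝ) < b := by exact_mod_cast (by omega : 0 < b)
  have hf0 : ∀ i, 0 ≤ f i := fun i => by positivity
  have hr0 : ∀ i, 0 ≤ r i := fun i => by positivity
  have hstep : ∀ i, f i + r (i + 1) ≤ r i := by
    intro i
    have hlt : (a i : ℝ) + 1 ≤ (b : ℝ) ^ digLen b (a i) := by
      exact_mod_cast Nat.lt_base_pow_length_digits (m := a i) (by omega : 1 < b)
    simp only [hf, hr]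
    rw [← add_div, Finset.sum_range_succ, pow_add, div_le_div_iff₀ (by positivity) (by positivity),
      one_mul, mul_comm]
    exact mul_le_mul_of_nonneg_left hlt (by positivity)
  have hanti : Antitone fun N => ∑ i ∈ Finset.range N, f i + r N := by
    refine antitone_nat_of_succ_le fun N => ?_
    rw [Finset.sum_range_succ]
    linarith [hstep N]
  have hmono : Monotone fun N => ∑ i ∈ Finset.range N, f i := by
    refine monotone_nat_of_le_succ fun N => ?_
    rw [Finset.sum_range_succ]
    linarith [hf0 N]
  have hbound : ∀ N, ∑ i ∈ Finset.range N, f i ≤ ∑ i ∈ Finset.range m, f i + r m := by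
    intro N
    rcases le_total m N with h | h
    · linarith [show _ ≤ _ from hanti h, hr0 N]
    · linarith [show _ ≤ _ from hmono h, hr0 m]
  have hsum : Summable f := summable_of_sum_range_le hf0 hbound
  exact ⟨hsum.sum_le_tsum _ fun i _ => hf0 i, hsum.tsum_le_of_sum_range_le hbound⟩

theorem digLen_eq {b c k : ℕ} (hb : 2 ≤ b) (h : b ^ k ≤ c) (h' : c ≤ b ^ (k + 1) - 1) :
    digLen b c = k + 1 := by
  have hpos : 0 < b ^ k := by positivity
  have hpos' : 0 < b ^ (k + 1) := by positivity
  rw [digLen, Nat.length_digits b c (by omega) (by omega),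
    Nat.log_eq_of_pow_le_of_lt_pow h (by omega)]

/-- Trott numbers in fundamental intervals with the same even prefix and last quotients of the
same magnitude cannot come from distinct last quotients. -/
theorem not_lt_of_isTrott_mem_uIoo {b : ℕ} (hb : 2 ≤ b) {L : List ℕ} (hL : Even L.length)
    (hLpos : ∀ d ∈ L, 0 < d) {k c₁ c₂ : ℕ} (hc₁ : b ^ k ≤ c₁) (hc₁' : c₁ ≤ b ^ (k + 1) - 1)
    (hc₂ : b ^ k ≤ c₂) (hc₂' : c₂ ≤ b ^ (k + 1) - 1)
    (h₁ : ∃ x ∈ Set.uIoo (cfVal (L ++ [c₁])) (cfVal (L ++ [c₁ + 1])), IsTrott b x)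
    (h₂ : ∃ x ∈ Set.uIoo (cfVal (L ++ [c₂])) (cfVal (L ++ [c₂ + 1])), IsTrott b x) :
    ¬ c₁ < c₂ := by
  intro hlt
  obtain ⟨x, hx, a, ha, hxa, hxs⟩ := h₁
  obtain ⟨y, hy, a', ha', hya, hys⟩ := h₂
  have hpos : 0 < b ^ k := by positivity
  have hmapa := map_range_eq_of_mem_uIoo L hLpos (by omega) ha hxa hx
  have hmapa' := map_range_eq_of_mem_uIoo L hLpos (by omega) ha' hya hy
  have hanti {c d : ℕ} (hc : 0 < c) (hcd : c ≤ d) : cfVal (L ++ [d]) ≤ cfVal (L ++ [c]) :=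
    (cfVal_append_singleton_le L hLpos hc hcd).1 hL
  have hyx : y < x := by
    rw [Set.uIoo_of_ge (hanti (by omega) (Nat.le_succ _))] at hx hy
    exact hy.2.trans_le ((hanti (by omega) hlt).trans hx.1.le)
  rw [List.range_succ, List.map_append, List.map_singleton] at hmapa hmapa'
  obtain ⟨hinit, hlast⟩ := List.append_inj' hmapa rfl
  obtain ⟨hinit', hlast'⟩ := List.append_inj' hmapa' rfl
  have hlast : a L.length = c₁ := by simpa using hlast
  have hlast' : a' L.length = c₂ := by simpa using hlast'
  have hagree : ∀ i < L.length, a i = a' i := fun i hi =>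
    List.map_inj_left.1 (hinit.trans hinit'.symm) i (List.mem_range.2 hi)
  have hexp : ∀ m ≤ L.length, ∑ j ∈ Finset.range m, digLen b (a j) =
      ∑ j ∈ Finset.range m, digLen b (a' j) := fun m hm =>
    Finset.sum_congr rfl fun j hj => by
      rw [hagree j ((Finset.mem_range.1 hj).trans_le hm)]
  have hsum : ∑ i ∈ Finset.range L.length,
        (a i : ℝ) / (b : ℝ) ^ (∑ j ∈ Finset.range (i + 1), digLen b (a j)) =
      ∑ i ∈ Finset.range L.length,
        (a' i : ℝ) / (b : ℝ) ^ (∑ j ∈ Finset.range (i + 1), digLen b (a' j)) :=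
    Finset.sum_congr rfl fun i hi => by
      rw [hexp _ (Finset.mem_range.1 hi), hagree i (Finset.mem_range.1 hi)]
  have hxle := (tsum_digits_mem_Icc hb a (L.length + 1)).2
  have hyge := (tsum_digits_mem_Icc hb a' (L.length + 1)).1
  rw [← hxs, Finset.sum_range_succ, hsum, Finset.sum_range_succ _ L.length,
    hexp _ le_rfl, hlast, digLen_eq hb hc₁ hc₁', add_assoc, ← add_div] at hxle
  rw [← hys, Finset.sum_range_succ, Finset.sum_range_succ _ L.length, hlast',
    digLen_eq hb hc₂ hc₂'] at hyge
  have hc : (c₁ : ℝ) + 1 ≤ c₂ := by exact_mod_cast hlt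
  have := div_le_div_of_nonneg_right hc
    (by positivity : (0 : ℝ) ≤ (b : ℝ) ^ (∑ j ∈ Finset.range L.length, digLen b (a' j) + (k + 1)))
  linarith

/-- For each even `n > 0`, each finite sequence `a₁, …, aₙ` of positive integers
(given as a list `L` of length `n`) and each `k ≥ 0`, there is at most one integer `c`
with `bᵏ ≤ c ≤ bᵏ⁺¹ − 1` such that the open interval with endpoints
`[0; a₁, …, aₙ, c]` and `[0; a₁, …, aₙ, c+1]` contains a Trott number in base `b`. -/
theorem trott_at_most_one_per_magnitude (b : ℕ) (hb : 2 ≤ b)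
    (n : ℕ) (hn : Even n) (hn0 : 0 < n)
    (L : List ℕ) (hL : L.length = n) (hLpos : ∀ d ∈ L, 0 < d) (k : ℕ)
    (c₁ c₂ : ℕ) (hc₁ : b ^ k ≤ c₁) (hc₁' : c₁ ≤ b ^ (k + 1) - 1)
    (hc₂ : b ^ k ≤ c₂) (hc₂' : c₂ ≤ b ^ (k + 1) - 1)
    (h₁ : ∃ x ∈ Set.uIoo (cfVal (L ++ [c₁])) (cfVal (L ++ [c₁ + 1])), IsTrott b x)
    (h₂ : ∃ x ∈ Set.uIoo (cfVal (L ++ [c₂])) (cfVal (L ++ [c₂ + 1])), IsTrott b x) :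
    c₁ = c₂ := by
  subst hL
  exact le_antisymm
    (not_lt.1 (not_lt_of_isTrott_mem_uIoo hb hn hLpos hc₂ hc₂' hc₁ hc₁' h₂ h₁))
    (not_lt.1 (not_lt_of_isTrott_mem_uIoo hb hn hLpos hc₁ hc₁' hc₂ hc₂' h₁ h₂))
end

section
/- Let k ≥ 2 be an integer and let b be an integer with k² < b < (k+1)². Then every digit in the non-terminating base-b expansion of 1/k is at least k. That is, if (c_j)_{j≥1} is the unique sequence of digits c_j ∈ {0,1,…,b−1}, not eventually all zero, with 1/k = ∑_{j=1}^∞ c_j b^{−j}, then c_j ≥ k for every j ≥ 1. -/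
open Filter Topology

/-- A digit expansion with a nonzero digit has positive value. -/
lemma ofDigits_pos_of_ne_zero {b : ℕ} (d : ℕ → Fin b) {n : ℕ} (hn : (d n : ℕ) ≠ 0) :
    0 < Real.ofDigits d := by
  have hb : 0 < b := (d n).pos
  refine Real.summable_ofDigitsTerm.tsum_pos (fun _ => Real.ofDigitsTerm_nonneg) n ?_
  have := Nat.pos_of_ne_zero hn
  unfold Real.ofDigitsTerm
  positivity

/-- Shifting a digit expansion by one place. -/
lemma mul_ofDigits_eq_add_ofDigits_succ {b : ℕ} (d : ℕ → Fin b) :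
    b * Real.ofDigits d = (d 0 : ℕ) + Real.ofDigits fun i => d (i + 1) := by
  have hb : (b : ℝ) ≠ 0 := by exact_mod_cast (d 0).pos.ne'
  rw [Real.ofDigits_eq_sum_add_ofDigits d 1]
  simp [Real.ofDigitsTerm]
  field_simp

/-- For `k ≥ 2` and `k² < b < (k+1)²`, every digit of the non-terminating base-`b`
expansion of `1/k` is at least `k`. Here the digits are `c j` (the digit at position
`j+1`), each in `{0, …, b−1}`, not eventually all zero, with `1/k = ∑ⱼ c j · b^{-(j+1)}`. -/
theorem trott_digits_of_one_over_k (k b : ℕ) (hk : 2 ≤ k)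
    (hb1 : k ^ 2 < b) (hb2 : b < (k + 1) ^ 2)
    (c : ℕ → ℕ) (hdig : ∀ j, c j < b) (hnz : ∀ N, ∃ j, N ≤ j ∧ c j ≠ 0)
    (hsum : (1 : ℝ) / (k : ℝ) = ∑' j : ℕ, (c j : ℝ) / (b : ℝ) ^ (j + 1)) :
    ∀ j, k ≤ c j := by
  have hk0 : (0 : ℝ) < k := by positivity
  let d : ℕ → Fin b := fun j => ⟨c j, hdig j⟩
  let T : ℕ → ℝ := fun j => Real.ofDigits fun i => d (i + j)
  have hT0 : T 0 = 1 / k := by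
    rw [hsum]
    simp [T, d, Real.ofDigits, Real.ofDigitsTerm, div_eq_mul_inv]
  have hTpos (j : ℕ) : 0 < T j := by
    obtain ⟨n, hjn, hn⟩ := hnz j
    refine ofDigits_pos_of_ne_zero _ (n := n - j) ?_
    simpa [d, Nat.sub_add_cancel hjn] using hn
  have hTle (j : ℕ) : T j ≤ 1 := Real.ofDigits_le_one _
  have hTsucc (j : ℕ) : b * T j = c j + T (j + 1) := by
    simpa [T, d, add_assoc, add_comm 1 j] using
      mul_ofDigits_eq_add_ofDigits_succ fun i => d (i + j)
  have hint (j : ℕ) : ∃ m : ℤ, k * T j = m := by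
    induction j with
    | zero => exact ⟨1, by rw [hT0]; field_simp; norm_num⟩
    | succ j ih =>
      obtain ⟨m, hm⟩ := ih
      refine ⟨b * m - k * c j, ?_⟩
      push_cast
      rw [← hm]
      linear_combination -(k : ℝ) * hTsucc j
  intro j
  obtain ⟨m, hm⟩ := hint j
  have hm1 : (1 : ℝ) ≤ k * T j := by
    have : (0 : ℝ) < m := hm ▸ mul_pos hk0 (hTpos j)
    rw [hm]
    exact_mod_cast this
  have hlow : (b : ℝ) ≤ k * c j + k := by
    have h1 : (b : ℝ) * 1 ≤ b * (k * T j) := by gcongr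
    have h2 : (k : ℝ) * T (j + 1) ≤ k * 1 := by gcongr; exact hTle _
    linarith [congrArg (fun x : ℝ => k * x) (hTsucc j)]
  have hlow' : b ≤ k * c j + k := by exact_mod_cast hlow
  by_contra! hlt
  nlinarith
end
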